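/- arXiv:1208.2113 — 2 statements merged into one kernel-verified Lean document; each statement's English description precedes it below -/
import Mathlib

section
/- Let w = (w_1,…,w_n) be a weight vector (w_i ≥ 0, Σ_i w_i = 1) and define the empirical distortion risk ρ_w(y) = −Σ_{i=1}^n w_i y_{[i]} for y ∈ ℝ^n, where y_{[1]} ≥ … ≥ y_{[n]} is the decreasing rearrangement of y. Then ρ_w is subadditive, i.e. ρ_w(y+z) ≤ ρ_w(y) + ρ_w(z) for all y, z ∈ ℝ^n, if and only if w is ordered, i.e. w_1 ≤ w_2 ≤ … ≤ w_n. (The empirical distortion risk measure is coherent if and only if its weights are ordered.) -/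
/-- The decreasing rearrangement of `y`: `decSort y i` is the `i`-th largest entry of `y`. -/
noncomputable def decSort {n : ℕ} (y : Fin n → ℝ) : Fin n → ℝ :=
  fun i => y (Tuple.sort y i.rev)

/-- The decreasing rearrangement is invariant under permutations of the entries. -/
lemma decSort_comp_perm {n : ℕ} (y : Fin n → ℝ) (σ : Equiv.Perm (Fin n)) :
    decSort (y ∘ σ) = decSort y := by
  funext i
  exact congrFun (Tuple.comp_perm_comp_sort_eq_comp_sort (f := y) (σ := σ)) i.rev

lemma decSort_of_antitone {n : ℕ} {y : Fin n → ℝ} (hy : Antitone y) : decSort y = y := by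
  have h : y ∘ Fin.revPerm = y ∘ Tuple.sort y :=
    Tuple.comp_sort_eq_comp_iff_monotone.2 fun a b hab => hy (Fin.rev_le_rev.2 hab)
  funext i
  simpa [decSort] using (congrFun h i.rev).symm

lemma decSort_antitone {n : ℕ} (y : Fin n → ℝ) : Antitone (decSort y) :=
  fun _ _ hab => Tuple.monotone_sort y (Fin.rev_le_rev.2 hab)

lemma sum_mul_decSort_le_sum_mul_comp_perm {n : ℕ} {w : Fin n → ℝ} (hw : Monotone w)
    (y : Fin n → ℝ) (σ : Equiv.Perm (Fin n)) :
    ∑ i, w i * decSort y i ≤ ∑ i, w i * y (σ i) := by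
  have h := (hw.antivary (decSort_antitone y)).sum_mul_le_sum_mul_comp_perm
    (σ := σ.trans ((Fin.revPerm.trans (Tuple.sort y)).symm))
  refine h.trans_eq (Finset.sum_congr rfl fun i _ => ?_)
  simp [decSort]

/-- For `b k = -k`, subadditivity at `b` and `b` with two adjacent entries exchanged compares
the corresponding weights. -/
lemma le_of_decSort_subadditive {n : ℕ} {w : Fin n → ℝ}
    (h : ∀ y z : Fin n → ℝ, ∑ i, w i * decSort y i + ∑ i, w i * decSort z i ≤
      ∑ i, w i * decSort (y + z) i)
    {i j : Fin n} (hij : (j : ℕ) = i + 1) : w i ≤ w j := by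
  have hne : i ≠ j := by rintro rfl; omega
  let b : Fin n → ℝ := fun k => -(k : ℕ)
  have hb : Antitone b := fun k l hkl => neg_le_neg (Nat.cast_le.2 hkl)
  have hsum : Antitone (b + b ∘ Equiv.swap i j) := by
    intro k l hkl
    have hnat : (k : ℕ) + (Equiv.swap i j k : Fin n) ≤ l + (Equiv.swap i j l : Fin n) := by
      have hkl' : (k : ℕ) ≤ l := hkl
      simp only [Equiv.swap_apply_def]
      split_ifs <;> simp_all [Fin.ext_iff] <;> omega
    have hreal : ((k : ℕ) : ℝ) + ((Equiv.swap i j k : Fin n) : ℕ) ≤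
        (l : ℕ) + ((Equiv.swap i j l : Fin n) : ℕ) := by exact_mod_cast hnat
    simp only [b, Pi.add_apply, Function.comp_apply]
    linarith
  have key := h b (b ∘ Equiv.swap i j)
  rw [decSort_comp_perm, decSort_of_antitone hb, decSort_of_antitone hsum] at key
  simp only [Pi.add_apply, Function.comp_apply, mul_add, Finset.sum_add_distrib] at key
  have hdiff : ∑ k, (w k * b (Equiv.swap i j k) - w k * b k) =
      (w i * b j - w i * b i) + (w j * b i - w j * b j) := by
    rw [Fintype.sum_eq_add i j hne, Equiv.swap_apply_left, Equiv.swap_apply_right]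
    rintro k ⟨hki, hkj⟩
    rw [Equiv.swap_apply_of_ne_of_ne hki hkj, sub_self]
  rw [Finset.sum_sub_distrib] at hdiff
  have hbj : b j = b i - 1 := by simp only [b, hij]; push_cast; ring
  rw [hbj] at hdiff
  linarith

/-- The empirical distortion risk measure `ρ_w(y) = -∑ i, w i * y_[i]` (with `y_[i]` the
`i`-th largest entry of `y`) is subadditive if and only if the weight vector `w` is
ordered, i.e. increasing. -/
theorem stmt8 {n : ℕ} (w : Fin n → ℝ) (hw0 : ∀ j, 0 ≤ w j) (hw1 : ∑ j, w j = 1) :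
    (∀ y z : Fin n → ℝ,
        -∑ i, w i * decSort (y + z) i ≤
          (-∑ i, w i * decSort y i) + (-∑ i, w i * decSort z i)) ↔
      Monotone w := by
  constructor
  · intro h
    have h' (y z : Fin n → ℝ) : ∑ i, w i * decSort y i + ∑ i, w i * decSort z i ≤
        ∑ i, w i * decSort (y + z) i := by linarith [h y z]
    cases n with
    | zero => exact fun i => i.elim0
    | succ m => exact Fin.monotone_iff_le_succ.2 fun i => le_of_decSort_subadditive h' (by simp)
  · intro hw y z
    let σ : Equiv.Perm (Fin n) := Fin.revPerm.trans (Tuple.sort (y + z))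
    have hsplit : ∑ i, w i * decSort (y + z) i =
        ∑ i, w i * y (σ i) + ∑ i, w i * z (σ i) := by
      simp [decSort, σ, mul_add, Finset.sum_add_distrib]
    linarith [sum_mul_decSort_le_sum_mul_comp_perm hw y σ,
      sum_mul_decSort_le_sum_mul_comp_perm hw z σ]
end

section
/- Lipschitz continuity of WM regions in the weights: let a^1,…,a^n ∈ ℝ^d and let w and v be weight vectors. Then the Hausdorff distance between the WM regions satisfies d_H( D_w(a^1,…,a^n), D_v(a^1,…,a^n) ) ≤ ( Σ_{j=1}^n |w_j − v_j| ) · max_{1 ≤ i ≤ n} ‖a^i‖. -/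
open scoped RealInnerProductSpace Pointwise

/-- The weighted-mean (WM) region of points `a 1, …, a n` with weight vector `w`:
the convex hull of all weighted sums `∑ j, w j • a (π j)` over permutations `π`. -/
noncomputable def wmRegion {d n : ℕ} (w : Fin n → ℝ)
    (a : Fin n → EuclideanSpace ℝ (Fin d)) : Set (EuclideanSpace ℝ (Fin d)) :=
  convexHull ℝ {x | ∃ π : Equiv.Perm (Fin n), x = ∑ j, w j • a (π j)}

/-- One-sided estimate: every point of the WM region for `w` is within
`(∑ j, |w j - v j|) * max_i ‖a i‖` of the WM region for `v`. -/
theorem exists_mem_wmRegion_dist_le {d n : ℕ} (w v : Fin n → ℝ)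
    (a : Fin n → EuclideanSpace ℝ (Fin d)) {x : EuclideanSpace ℝ (Fin d)}
    (hx : x ∈ wmRegion w a) :
    ∃ y ∈ wmRegion v a, dist x y ≤ (∑ j, |w j - v j|) * ⨆ i, ‖a i‖ := by
  have hsub : wmRegion w a ⊆
      wmRegion v a + Metric.closedBall 0 ((∑ j, |w j - v j|) * ⨆ i, ‖a i‖) := by
    refine convexHull_min ?_ ((convex_convexHull ℝ _).add (convex_closedBall _ _))
    rintro _ ⟨π, rfl⟩
    refine Set.mem_add.2 ⟨∑ j, v j • a (π j), subset_convexHull ℝ _ ⟨π, rfl⟩,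
      ∑ j, (w j - v j) • a (π j), ?_, ?_⟩
    · rw [mem_closedBall_zero_iff, Finset.sum_mul]
      refine norm_sum_le_of_le _ fun j _ => ?_
      rw [norm_smul, Real.norm_eq_abs]
      gcongr
      exact le_ciSup (f := fun i => ‖a i‖) (Set.finite_range _).bddAbove (π j)
    · simp [sub_smul]
  obtain ⟨y, hy, z, hz, rfl⟩ := Set.mem_add.1 (hsub hx)
  exact ⟨y, hy, by simpa using hz⟩

/-- Lipschitz continuity of WM regions in the weights: the Hausdorff distance between the
WM regions for two weight vectors `w` and `v` is at most
`(∑ j, |w j - v j|) * max_i ‖a i‖`. -/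
theorem stmt15 {d n : ℕ} (w v : Fin n → ℝ)
    (hw0 : ∀ j, 0 ≤ w j) (hw1 : ∑ j, w j = 1)
    (hv0 : ∀ j, 0 ≤ v j) (hv1 : ∑ j, v j = 1)
    (a : Fin n → EuclideanSpace ℝ (Fin d)) :
    Metric.hausdorffDist (wmRegion w a) (wmRegion v a) ≤
      (∑ j, |w j - v j|) * ⨆ i, ‖a i‖ := by
  refine Metric.hausdorffDist_le_of_mem_dist
    (mul_nonneg (Finset.sum_nonneg fun j _ => abs_nonneg _)
      (Real.iSup_nonneg fun i => norm_nonneg _))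
    (fun x hx => exists_mem_wmRegion_dist_le w v a hx) fun x hx => ?_
  simpa only [abs_sub_comm] using exists_mem_wmRegion_dist_le v w a hx
end
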